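/- arXiv:0909.0865 — 2 statements merged into one kernel-verified Lean document; each statement's English description precedes it below -/
import Mathlib

section
/- (Theorem 1, abstract form) The map φ^⊙ satisfies φ^⊙(x ⊙₀ y) = φ^⊙(x) ⊙₀ φ^⊙(y) for all x, y ∈ A; that is, φ^⊙ is a homomorphism from (A, ⊙₀) to (B, ⊙₀). Moreover, for each w ∈ W and v ∈ V, the coefficient of f_v in φ^⊙(e_w) is either 0 or equal to the coefficient d_w^v of f_v in φ(e_w). -/
/-- The bilinear product on a free `ℤ`-module with prescribed structure constants. -/
noncomputable def structureProduct {ι M : Type*} [Fintype ι] [AddCommGroup M]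
    (b : Module.Basis ι ℤ M) (c : ι → ι → ι → ℤ) : M →ₗ[ℤ] M →ₗ[ℤ] M :=
  b.constr ℤ fun u => b.constr ℤ fun v => ∑ w, c u v w • b w

theorem structureProduct_apply {ι M : Type*} [Fintype ι] [AddCommGroup M]
    (b : Module.Basis ι ℤ M) (c : ι → ι → ι → ℤ) (x y : M) :
    structureProduct b c x y =
      ∑ u, ∑ v, ∑ w, (b.repr x u * b.repr y v * c u v w) • b w := by
  simp only [structureProduct, Module.Basis.constr_apply_fintype, LinearMap.sum_apply,
    LinearMap.smul_apply, Module.Basis.equivFun_apply, Finset.smul_sum, mul_smul]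

theorem structureProduct_basis {ι M : Type*} [Fintype ι] [AddCommGroup M]
    (b : Module.Basis ι ℤ M) (c : ι → ι → ι → ℤ) (u v : ι) :
    structureProduct b c (b u) (b v) = ∑ w, c u v w • b w := by
  rw [structureProduct, Module.Basis.constr_basis, Module.Basis.constr_basis]

/-- A linear map given by a matrix `m` intertwines two structure products as soon as the
structure constants satisfy the corresponding polynomial identities. -/
theorem map_structureProduct {ι κ M N : Type*} [Fintype ι] [Fintype κ]
    [AddCommGroup M] [AddCommGroup N] (b : Module.Basis ι ℤ M) (b' : Module.Basis κ ℤ N)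
    (c : ι → ι → ι → ℤ) (c' : κ → κ → κ → ℤ) (m : ι → κ → ℤ) (g : M →ₗ[ℤ] N)
    (hg : ∀ w, g (b w) = ∑ v, m w v • b' v)
    (h : ∀ u v t, ∑ w, c u v w * m w t = ∑ p, ∑ q, m u p * m v q * c' p q t) (x y : M) :
    g (structureProduct b c x y) = structureProduct b' c' (g x) (g y) := by
  have key : (structureProduct b c).compr₂ g = (structureProduct b' c').compl₁₂ g g := by
    refine b.ext fun u => b.ext fun v => b'.ext_elem fun t => ?_
    have hrepr : ∀ w s, b'.repr (g (b w)) s = m w s := fun w s => by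
      rw [hg, b'.repr_sum_self]
    rw [LinearMap.compr₂_apply, LinearMap.compl₁₂_apply, structureProduct_basis,
      structureProduct_apply]
    simp only [map_sum, map_smul, Finsupp.coe_finsetSum, Finset.sum_apply, Finsupp.smul_apply,
      hrepr, b'.repr_self, smul_eq_mul]
    rw [h]
    classical simp [Finsupp.single_apply]
  exact LinearMap.congr_fun₂ key x y

/-- The identities between structure constants expressing that a ring homomorphism is
multiplicative on basis elements. -/
theorem sum_structureConstants_eq {W V A B : Type*} [Fintype W] [Fintype V]
    [CommRing A] [CommRing B] (e : Module.Basis W ℤ A) (f : Module.Basis V ℤ B)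
    (d : W → W → W → ℤ) (hd : ∀ u v : W, e u * e v = ∑ w, d u v w • e w)
    (δ : V → V → V → ℤ) (hδ : ∀ u v : V, f u * f v = ∑ w, δ u v w • f w)
    (φ : A →+* B) (m : W → V → ℤ) (hφ : ∀ w : W, φ (e w) = ∑ v, m w v • f v)
    (u v : W) (t : V) :
    ∑ w, d u v w * m w t = ∑ p, ∑ q, m u p * m v q * δ p q t := by
  classical
  have h := congrArg (fun z => f.repr z t) (map_mul φ (e u) (e v))
  simp only [hd, map_sum, map_zsmul, hφ, Finset.sum_mul_sum, smul_mul_smul_comm, hδ] at h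
  simpa [Finsupp.single_apply] using h

/-- Theorem 1 (abstract form): the map `φ^⊙` obtained from a ring homomorphism
`φ : A → B` by keeping only the coefficients `d_w^v` with `η v = χ w` is a
homomorphism from `(A, ⊙₀)` to `(B, ⊙₀)`; moreover each coefficient of
`φ^⊙(e w)` on `f v` is either `0` or equal to the corresponding coefficient
`d_w^v` of `φ(e w)`. -/
theorem bk_comorphism_hom
    {W V : Type*} [Fintype W] [Fintype V]
    {A B : Type*} [CommRing A] [CommRing B]
    (e : Module.Basis W ℤ A) (f : Module.Basis V ℤ B)
    (d : W → W → W → ℤ)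
    (hd : ∀ u v : W, e u * e v = ∑ w, d u v w • e w)
    (χ : W → ℤ)
    (hχ : ∀ u v w : W, d u v w ≠ 0 → χ u + χ v ≤ χ w)
    (δ : V → V → V → ℤ)
    (hδ : ∀ u v : V, f u * f v = ∑ w, δ u v w • f w)
    (η : V → ℤ)
    (hη : ∀ u v w : V, δ u v w ≠ 0 → η u + η v ≤ η w)
    (φ : A →+* B)
    (dφ : W → V → ℤ)
    (hφ : ∀ w : W, φ (e w) = ∑ v, dφ w v • f v)
    (hφη : ∀ (w : W) (v : V), dφ w v ≠ 0 → χ w ≤ η v)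
    (odotA : A → A → A)
    (hA : ∀ x y : A, odotA x y =
      ∑ u, ∑ v, ∑ w, ((e.repr x u) * (e.repr y v) *
        (if χ w = χ u + χ v then d u v w else 0)) • e w)
    (odotB : B → B → B)
    (hB : ∀ x y : B, odotB x y =
      ∑ u, ∑ v, ∑ w, ((f.repr x u) * (f.repr y v) *
        (if η w = η u + η v then δ u v w else 0)) • f w)
    (φodot : A →ₗ[ℤ] B)
    (hφodot : ∀ w : W, φodot (e w) = ∑ v, (if η v = χ w then dφ w v else 0) • f v) :
    (∀ x y : A, φodot (odotA x y) = odotB (φodot x) (φodot y)) ∧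
    (∀ (w : W) (v : V), f.repr (φodot (e w)) v = 0 ∨
      f.repr (φodot (e w)) v = dφ w v) := by
  constructor
  · have hA' : ∀ x y, odotA x y = structureProduct e
        (fun u v w => if χ w = χ u + χ v then d u v w else 0) x y := fun x y => by
      rw [hA, structureProduct_apply]
    have hB' : ∀ x y, odotB x y = structureProduct f
        (fun u v w => if η w = η u + η v then δ u v w else 0) x y := fun x y => by
      rw [hB, structureProduct_apply]
    intro x y
    rw [hA', hB']
    refine map_structureProduct e f _ _ _ φodot hφodot (fun u v t => ?_) x y
    by_cases ht : η t = χ u + χ v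
    · have h := sum_structureConstants_eq e f d hd δ hδ φ dφ hφ u v t
      convert h using 1
      · refine Finset.sum_congr rfl fun w _ => ?_
        have h₁ := hχ u v w
        have h₂ := hφη w t
        grind
      · refine Finset.sum_congr rfl fun p _ => Finset.sum_congr rfl fun q _ => ?_
        have h₁ := hφη u p
        have h₂ := hφη v q
        have h₃ := hη p q t
        grind
    · rw [Finset.sum_eq_zero, Finset.sum_eq_zero]
      · exact fun p _ => Finset.sum_eq_zero fun q _ => by grind
      · exact fun w _ => by grind
  · intro w v
    rw [hφodot, f.repr_sum_self]
    grind
end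

section
/- (Proposition 3.2, abstract form) The map φ• is multiplicative for the products ⊙•: for all x, y ∈ A[τ], φ•(x ⊙• y) = φ•(x) ⊙• φ•(y). -/
/-- Monomials with integer exponents multiply by adding exponents, provided that an exponent is
nonnegative whenever its coefficient is nonzero. -/
theorem C_mul_X_pow_toNat_mul {R : Type*} [CommSemiring R] {a b : R} {m n : ℤ}
    (ha : a ≠ 0 → 0 ≤ m) (hb : b ≠ 0 → 0 ≤ n) :
    (Polynomial.C a * Polynomial.X ^ m.toNat) * (Polynomial.C b * Polynomial.X ^ n.toNat) =
      Polynomial.C (a * b) * Polynomial.X ^ (m + n).toNat := by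
  by_cases ha0 : a = 0
  · simp [ha0]
  by_cases hb0 : b = 0
  · simp [hb0]
  rw [Int.toNat_add (ha ha0) (hb hb0), pow_add, Polynomial.C_mul]
  ring

/-- Multiplicativity of a ring homomorphism in terms of structure constants. -/
theorem sum_structureConst_mul_eq {W V A B : Type*} [Fintype W] [Fintype V]
    [CommRing A] [CommRing B] {e : W → A} (f : Module.Basis V ℤ B)
    {d : W → W → W → ℤ} (hd : ∀ u v, e u * e v = ∑ w, d u v w • e w)
    {δ : V → V → V → ℤ} (hδ : ∀ u v, f u * f v = ∑ w, δ u v w • f w)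
    (φ : A →+* B) {dφ : W → V → ℤ} (hφ : ∀ w, φ (e w) = ∑ v, dφ w v • f v)
    (u v : W) (z : V) :
    ∑ w, d u v w * dφ w z = ∑ a, ∑ b, dφ u a * dφ v b * δ a b z := by
  classical
  have h := congrArg (fun t => f.repr t z) (map_mul φ (e u) (e v))
  simpa [hd, hφ, hδ, Finset.sum_mul_sum,
    Finsupp.single_apply, -zsmul_eq_mul, mul_assoc, mul_left_comm] using h

/-- Proposition 3.2 (abstract form): the `ℤ[τ]`-linear map `φ•` defined on basis
elements by `φ•(e_w) = Σ_v τ^(η v - χ w) d_w^v f_v` is multiplicative for the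
products `⊙•` on `A[τ]` and `B[τ]`.  Here `A[τ]` is modelled as `W → ℤ[τ]` (the
coordinates on the basis `(e_w)`) and `B[τ]` as `V → ℤ[τ]`. -/
theorem bk_tau_comorphism_multiplicative
    {W V : Type*} [Fintype W] [Fintype V]
    {A B : Type*} [CommRing A] [CommRing B]
    (e : Module.Basis W ℤ A) (f : Module.Basis V ℤ B)
    (d : W → W → W → ℤ)
    (hd : ∀ u v : W, e u * e v = ∑ w, d u v w • e w)
    (χ : W → ℤ)
    (hχ : ∀ u v w : W, d u v w ≠ 0 → χ u + χ v ≤ χ w)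
    (δ : V → V → V → ℤ)
    (hδ : ∀ u v : V, f u * f v = ∑ w, δ u v w • f w)
    (η : V → ℤ)
    (hη : ∀ u v w : V, δ u v w ≠ 0 → η u + η v ≤ η w)
    (φ : A →+* B)
    (dφ : W → V → ℤ)
    (hφ : ∀ w : W, φ (e w) = ∑ v, dφ w v • f v)
    (hφη : ∀ (w : W) (v : V), dφ w v ≠ 0 → χ w ≤ η v)
    (odotA : (W → Polynomial ℤ) → (W → Polynomial ℤ) → (W → Polynomial ℤ))
    (hA : ∀ (x y : W → Polynomial ℤ) (w : W), odotA x y w =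
      ∑ u, ∑ v, x u * y v *
        (Polynomial.C (d u v w) * Polynomial.X ^ (χ w - χ u - χ v).toNat))
    (odotB : (V → Polynomial ℤ) → (V → Polynomial ℤ) → (V → Polynomial ℤ))
    (hB : ∀ (x y : V → Polynomial ℤ) (w : V), odotB x y w =
      ∑ u, ∑ v, x u * y v *
        (Polynomial.C (δ u v w) * Polynomial.X ^ (η w - η u - η v).toNat))
    (φbul : (W → Polynomial ℤ) → (V → Polynomial ℤ))
    (hφbul : ∀ (x : W → Polynomial ℤ) (v : V), φbul x v =
      ∑ w, x w * (Polynomial.C (dφ w v) * Polynomial.X ^ (η v - χ w).toNat)) :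
    ∀ x y : W → Polynomial ℤ, φbul (odotA x y) = odotB (φbul x) (φbul y) := by
  intro x y
  funext z
  rw [hφbul, hB]
  simp only [hA, hφbul]
  have hleft (u v : W) :
      ∑ w, (Polynomial.C (d u v w) * Polynomial.X ^ (χ w - χ u - χ v).toNat) *
        (Polynomial.C (dφ w z) * Polynomial.X ^ (η z - χ w).toNat) =
      Polynomial.C (∑ w, d u v w * dφ w z) * Polynomial.X ^ (η z - χ u - χ v).toNat := by
    rw [map_sum, Finset.sum_mul]
    refine Finset.sum_congr rfl fun w _ => ?_
    rw [C_mul_X_pow_toNat_mul (fun h => by linarith [hχ u v w h])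
      (fun h => by linarith [hφη w z h])]
    congr 3
    ring
  have hright (u v : W) :
      ∑ a, ∑ b, (Polynomial.C (dφ u a) * Polynomial.X ^ (η a - χ u).toNat) *
        (Polynomial.C (dφ v b) * Polynomial.X ^ (η b - χ v).toNat) *
        (Polynomial.C (δ a b z) * Polynomial.X ^ (η z - η a - η b).toNat) =
      Polynomial.C (∑ a, ∑ b, dφ u a * dφ v b * δ a b z) *
        Polynomial.X ^ (η z - χ u - χ v).toNat := by
    simp only [map_sum, Finset.sum_mul]
    refine Finset.sum_congr rfl fun a _ => Finset.sum_congr rfl fun b _ => ?_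
    rw [C_mul_X_pow_toNat_mul (fun h => by linarith [hφη u a h])
      (fun h => by linarith [hφη v b h]), C_mul_X_pow_toNat_mul
      (fun h => by linarith [hφη u a (left_ne_zero_of_mul h), hφη v b (right_ne_zero_of_mul h)])
      (fun h => by linarith [hη a b z h])]
    congr 3
    ring
  calc
    _ = ∑ u, ∑ v, x u * y v *
        ∑ w, (Polynomial.C (d u v w) * Polynomial.X ^ (χ w - χ u - χ v).toNat) *
          (Polynomial.C (dφ w z) * Polynomial.X ^ (η z - χ w).toNat) := by
      simp only [Finset.sum_mul, Finset.mul_sum]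
      rw [Finset.sum_comm]
      refine Finset.sum_congr rfl fun u _ => ?_
      rw [Finset.sum_comm]
      simp only [mul_assoc]
    _ = ∑ u, ∑ v, x u * y v *
        ∑ a, ∑ b, (Polynomial.C (dφ u a) * Polynomial.X ^ (η a - χ u).toNat) *
          (Polynomial.C (dφ v b) * Polynomial.X ^ (η b - χ v).toNat) *
          (Polynomial.C (δ a b z) * Polynomial.X ^ (η z - η a - η b).toNat) := by
      simp only [hleft, hright, sum_structureConst_mul_eq f hd hδ φ hφ]
    _ = _ := by
      simp only [Finset.sum_mul, Finset.mul_sum, ← Fintype.sum_prod_type']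
      refine Finset.sum_nbij' (fun p => (p.2.2.1, p.2.2.2, p.2.1, p.1))
        (fun p => (p.2.2.2, p.2.2.1, p.1, p.2.1)) ?_ ?_ ?_ ?_ ?_ <;> intros <;>
        try simp only [Finset.mem_univ]
      ring
end
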